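/- Let H_1, …, H_m be nonabelian simple groups and let Γ be a subgroup of the direct product H_1 × ⋯ × H_m such that the projection of Γ onto each factor H_i is surjective. Then Γ is a diagonal subgroup: there exist a partition of the index set {1, …, m} into blocks, for each block a distinguished index i in that block, and group isomorphisms L_j : H_i ≅ H_j for every other index j in the same block, such that Γ consists exactly of those tuples (x_1, …, x_m) satisfying x_j = L_j(x_i) for every block and every index j in that block. In particular, if no two factors H_i, H_j (i ≠ j) are isomorphic, then Γ is the whole product H_1 × ⋯ × H_m. -/

import Mathlib

namespace MonoidHom

open scoped commutatorElement

variable {G : Type*} [Group G]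

/-- The image of a normal subgroup under a surjection onto a simple group is everything, unless
the subgroup is contained in the kernel. -/
theorem map_eq_top_of_not_le_ker {H : Type*} [Group H] [IsSimpleGroup H] {f : G →* H}
    (hf : Function.Surjective f) {N : Subgroup G} (hN : N.Normal) (hle : ¬ N ≤ f.ker) :
    N.map f = ⊤ :=
  ((hN.map f hf).eq_bot_or_eq_top).resolve_left fun h => hle ((N.map_eq_bot_iff).1 h)

/-- Kernels of surjections onto simple groups are maximal normal subgroups. -/
theorem ker_eq_of_ker_le {H K : Type*} [Group H] [IsSimpleGroup H] [Group K] [Nontrivial K]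
    {f : G →* H} {g : G →* K} (hf : Function.Surjective f) (hg : Function.Surjective g)
    (hle : f.ker ≤ g.ker) : f.ker = g.ker := by
  refine le_antisymm hle (by_contra fun hn => ?_)
  have htop := map_eq_top_of_not_le_ker hf g.normal_ker hn
  obtain ⟨k, hk⟩ := exists_ne (1 : K)
  obtain ⟨x, rfl⟩ := hg k
  obtain ⟨y, hy, hyx⟩ : f x ∈ g.ker.map f := htop ▸ Subgroup.mem_top _
  have hmem : x * y⁻¹ ∈ g.ker := hle (by simp [MonoidHom.mem_ker, hyx])
  exact hk (by simpa [MonoidHom.mem_ker, (MonoidHom.mem_ker).1 hy] using hmem)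

/-- Two normal subgroups surjecting onto a nonabelian simple group have an intersection which
surjects as well. -/
theorem map_inf_eq_top {H : Type*} [Group H] [IsSimpleGroup H]
    (hH : ¬ ∀ a b : H, a * b = b * a) {f : G →* H} (hf : Function.Surjective f)
    {M N : Subgroup G} (hM : M.Normal) (hN : N.Normal) (hMf : M.map f = ⊤) (hNf : N.map f = ⊤) :
    (M ⊓ N).map f = ⊤ := by
  refine map_eq_top_of_not_le_ker hf inferInstance fun hle => hH fun a b => ?_
  obtain ⟨x, hx, rfl⟩ : a ∈ M.map f := hMf ▸ Subgroup.mem_top _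
  obtain ⟨y, hy, rfl⟩ : b ∈ N.map f := hNf ▸ Subgroup.mem_top _
  have hxy : f ⁅x, y⁆ = 1 :=
    hle (Subgroup.commutator_le_inf M N (Subgroup.commutator_mem_commutator hx hy))
  rwa [map_commutatorElement, commutatorElement_eq_one_iff_mul_comm] at hxy

/-- If finitely many surjections onto simple groups have kernels other than that of `f i`, then
`f i` stays surjective on the intersection of these kernels. -/
theorem map_biInf_ker_eq_top {ι : Type*} {H : ι → Type*} [∀ i, Group (H i)]
    [∀ i, IsSimpleGroup (H i)] (f : ∀ i, G →* H i) (hf : ∀ i, Function.Surjective (f i)) {i : ι}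
    (hH : ¬ ∀ a b : H i, a * b = b * a) (S : Finset ι)
    (hS : ∀ j ∈ S, (f j).ker ≠ (f i).ker) :
    (⨅ j ∈ S, (f j).ker).map (f i) = ⊤ := by
  classical
  induction S using Finset.induction_on with
  | empty => simpa [← MonoidHom.range_eq_map] using MonoidHom.range_eq_top.2 (hf i)
  | insert j S _ ih =>
    rw [Finset.iInf_insert]
    refine map_inf_eq_top hH (hf i) (f j).normal_ker ?_ ?_
      (ih fun k hk => hS k (Finset.mem_insert_of_mem hk))
    · exact Subgroup.normal_iInf_normal fun k => Subgroup.normal_iInf_normal fun _ =>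
        (f k).normal_ker
    · exact map_eq_top_of_not_le_ker (hf i) (f j).normal_ker fun hle =>
        hS j (Finset.mem_insert_self j S) (ker_eq_of_ker_le (hf j) (hf i) hle)

/-- Surjections onto nonabelian simple groups with pairwise distinct kernels are jointly
surjective. -/
theorem exists_forall_mem_eq_of_ker_injOn {ι : Type*} {H : ι → Type*} [∀ i, Group (H i)]
    [∀ i, IsSimpleGroup (H i)] (hH : ∀ i, ¬ ∀ a b : H i, a * b = b * a)
    (f : ∀ i, G →* H i) (hf : ∀ i, Function.Surjective (f i)) (S : Finset ι)
    (hS : Set.InjOn (fun i => (f i).ker) S) (x : ∀ i, H i) :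
    ∃ g : G, ∀ i ∈ S, f i g = x i := by
  classical
  induction S using Finset.induction_on with
  | empty => exact ⟨1, by simp⟩
  | insert i S hi ih =>
    obtain ⟨g, hg⟩ := ih (hS.mono (by simp))
    have htop := map_biInf_ker_eq_top f hf (hH i) S fun j hj he =>
      hi (hS (by simp [hj]) (by simp) he ▸ hj)
    obtain ⟨h, hh, hhi⟩ : (f i g)⁻¹ * x i ∈ (⨅ j ∈ S, (f j).ker).map (f i) :=
      htop ▸ Subgroup.mem_top _
    refine ⟨g * h, fun j hj => ?_⟩
    rcases Finset.mem_insert.1 hj with rfl | hj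
    · simp [hhi]
    · have hhj : f j h = 1 := by
        simp only [SetLike.mem_coe, Subgroup.mem_iInf, MonoidHom.mem_ker] at hh
        exact hh j hj
      simp [hhj, hg j hj]

/-- Two surjections with the same kernel differ by an isomorphism of their codomains. -/
theorem exists_mulEquiv_of_ker_eq {H K : Type*} [Group H] [Group K] {f : G →* H} {g : G →* K}
    (hf : Function.Surjective f) (hg : Function.Surjective g) (h : f.ker = g.ker) :
    ∃ e : H ≃* K, ∀ x, e (f x) = g x := by
  refine ⟨(QuotientGroup.quotientKerEquivOfSurjective f hf).symm.trans
    ((QuotientGroup.quotientMulEquivOfEq h).trans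
      (QuotientGroup.quotientKerEquivOfSurjective g hg)), fun x => ?_⟩
  have hx : (QuotientGroup.quotientKerEquivOfSurjective f hf).symm (f x) = (x : G ⧸ f.ker) :=
    (MulEquiv.symm_apply_eq _).2 rfl
  rw [MulEquiv.trans_apply, hx]
  rfl

end MonoidHom

/-- Hall's lemma: a subgroup `Γ` of a finite product of nonabelian simple groups
which projects onto each factor is a diagonal subgroup: there is a partition of the
index set (given by the fibers of an idempotent "representative" map `r`), and
isomorphisms `L j : H (r j) ≃* H j`, such that `Γ` consists exactly of the tuples
`x` with `x j = L j (x (r j))` for every non-representative index `j`. In particular,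
if no two distinct factors are isomorphic, then `Γ` is the whole product. -/
theorem hall_lemma (m : ℕ) (H : Fin m → Type*) [∀ i, Group (H i)]
    [∀ i, IsSimpleGroup (H i)] (hnonab : ∀ i, ¬ ∀ a b : H i, a * b = b * a)
    (Γ : Subgroup (∀ i, H i))
    (hsurj : ∀ i, Function.Surjective fun x : Γ => (x : ∀ i, H i) i) :
    (∃ (r : Fin m → Fin m) (_ : ∀ j, r (r j) = r j) (L : ∀ j, H (r j) ≃* H j),
        (Γ : Set (∀ i, H i)) = {x | ∀ j, r j ≠ j → x j = L j (x (r j))}) ∧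
    ((∀ i j : Fin m, i ≠ j → IsEmpty (H i ≃* H j)) → Γ = ⊤) := by
  classical
  let f : ∀ i, Γ →* H i := fun i => (Pi.evalMonoidHom H i).comp Γ.subtype
  have hf : ∀ i, Function.Surjective (f i) := hsurj
  let s : Setoid (Fin m) := Setoid.ker fun i => (f i).ker
  let r : Fin m → Fin m := fun j => (Quotient.mk s j).out
  have hker : ∀ j, (f (r j)).ker = (f j).ker := fun j => Quotient.mk_out (s := s) j
  have hrr : ∀ i j, (f i).ker = (f j).ker → r i = r j := fun i j h =>
    congrArg Quotient.out (Quotient.sound (s := s) h)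
  choose L hL using fun j => MonoidHom.exists_mulEquiv_of_ker_eq (hf (r j)) (hf j) (hker j)
  have hΓ : (Γ : Set (∀ i, H i)) = {x | ∀ j, r j ≠ j → x j = L j (x (r j))} := by
    ext x
    refine ⟨fun hx j _ => (hL j ⟨x, hx⟩).symm, fun hx => ?_⟩
    obtain ⟨g, hg⟩ := MonoidHom.exists_forall_mem_eq_of_ker_injOn hnonab f hf
      (Finset.univ.filter fun j => r j = j)
      (fun i hi j hj h => by
        simp only [Finset.coe_filter, Finset.mem_univ, true_and, Set.mem_ofPred_eq] at hi hj
        rw [← hi, ← hj]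
        exact hrr i j h) x
    simp only [Finset.mem_filter, Finset.mem_univ, true_and] at hg
    have hgx : (g : ∀ i, H i) = x := by
      funext j
      by_cases hj : r j = j
      · exact hg j hj
      · rw [hx j hj, ← hg (r j) (hrr _ _ (hker j))]
        exact (hL j g).symm
    exact hgx ▸ g.2
  refine ⟨⟨r, fun j => hrr _ _ (hker j), L, hΓ⟩, fun hiso => ?_⟩
  refine (Subgroup.eq_top_iff' Γ).2 fun x => ?_
  rw [← SetLike.mem_coe, hΓ]
  exact fun j hj => ((hiso _ _ hj).false (L j)).elim
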